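/- Let X be a T0 topological space. The following are equivalent: (1) X is a c-space; (2) the map ⋁ : I_T(X) → X has a continuous lower adjoint, i.e., there is a continuous map s : X → (I_T(X), Ω(I_T(X))) such that for all x ∈ X and A ∈ I_T(X), s(x) ⊆ A iff x ⊑ ⋁A; (3) X is a continuous retract of some b-space, i.e., there exist a b-space Y and continuous maps g : X → Y and f : Y → X with f ∘ g = id_X. -/

import Mathlib

open Set TopologicalSpace

universe u

variable {X : Type*}

/-- Specialization order: `x ⊑ y` iff `x ∈ cl {y}`. -/
def specLE (t : TopologicalSpace X) (x y : X) : Prop := x ∈ @closure X t {y}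

/-- `↑A` with respect to the specialization order. -/
def upSet (t : TopologicalSpace X) (A : Set X) : Set X := {z | ∃ a ∈ A, specLE t a z}

/-- `↓A` with respect to the specialization order. -/
def downSet (t : TopologicalSpace X) (A : Set X) : Set X := {z | ∃ a ∈ A, specLE t z a}

/-- A directed subset with respect to the specialization order. -/
def DirSet (t : TopologicalSpace X) (D : Set X) : Prop :=
  D.Nonempty ∧ ∀ a ∈ D, ∀ b ∈ D, ∃ c ∈ D, specLE t a c ∧ specLE t b c

/-- `D → x`: every open set containing `x` meets `D`. -/
def DConv (t : TopologicalSpace X) (D : Set X) (x : X) : Prop :=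
  ∀ U : Set X, t.IsOpen U → x ∈ U → (D ∩ U).Nonempty

/-- Directed-open subset. -/
def DirOpen (t : TopologicalSpace X) (U : Set X) : Prop :=
  ∀ D : Set X, DirSet t D → ∀ x ∈ U, DConv t D x → (D ∩ U).Nonempty

/-- A directed space: every directed-open set is open. -/
def DirSpace (t : TopologicalSpace X) : Prop :=
  ∀ U : Set X, DirOpen t U → t.IsOpen U

/-- `x ≪_d y`. -/
def dWay (t : TopologicalSpace X) (x y : X) : Prop :=
  ∀ D : Set X, DirSet t D → DConv t D y → ∃ d ∈ D, specLE t x d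

/-- c-space. -/
def CSpace (t : TopologicalSpace X) : Prop :=
  ∀ (x : X) (U : Set X), t.IsOpen U → x ∈ U → ∃ y ∈ U, x ∈ @interior X t (upSet t {y})

/-- b-space. -/
def BSpace (t : TopologicalSpace X) : Prop :=
  ∀ (x : X) (U : Set X), t.IsOpen U → x ∈ U →
    ∃ y ∈ U, t.IsOpen (upSet t {y}) ∧ x ∈ upSet t {y} ∧ upSet t {y} ⊆ U

/-- locally hypercompact space. -/
def LocallyHypercompact (t : TopologicalSpace X) : Prop :=
  ∀ (U : Set X), t.IsOpen U → ∀ x ∈ U, ∃ F : Set X, F.Finite ∧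
    x ∈ @interior X t (upSet t F) ∧ upSet t F ⊆ U

/-- `s` is the supremum of `A` with respect to the specialization order. -/
def IsSupOf (t : TopologicalSpace X) (A : Set X) (s : X) : Prop :=
  (∀ a ∈ A, specLE t a s) ∧ ∀ y : X, (∀ a ∈ A, specLE t a y) → specLE t s y

/-- Topological ideal: a directed lower set possessing a supremum to which it converges. -/
def TopIdeal (t : TopologicalSpace X) (A : Set X) : Prop :=
  DirSet t A ∧ downSet t A = A ∧ ∃ s : X, IsSupOf t A s ∧ DConv t A s

/-- The set `I_T(X)` of topological ideals. -/
abbrev IT (t : TopologicalSpace X) := {A : Set X // TopIdeal t A}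

/-- The family `Ω(I_T(X))`. -/
def OmegaOpen (t : TopologicalSpace X) (U : Set (IT t)) : Prop :=
  ∀ A : IT t, A ∈ U ↔ ∃ B ∈ U, (∃ x : X, B.1 = downSet t {x}) ∧ B.1 ⊆ A.1

/-- Way-below relation in a complete lattice. -/
def wayBelow {L : Type*} [CompleteLattice L] (a b : L) : Prop :=
  ∀ D : Set L, D.Nonempty → DirectedOn (· ≤ ·) D → b ≤ sSup D → ∃ d ∈ D, a ≤ d

/-- Continuous (complete) lattice. -/
def ContinuousLattice (L : Type*) [CompleteLattice L] : Prop :=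
  ∀ x : L, {a : L | wayBelow a x}.Nonempty ∧ DirectedOn (· ≤ ·) {a : L | wayBelow a x} ∧
    sSup {a : L | wayBelow a x} = x

/-- Completely distributive complete lattice. -/
def CompletelyDistrib (L : Type u) [CompleteLattice L] : Prop :=
  ∀ (ι : Type u) (κ : ι → Type u) (f : (i : ι) → κ i → L),
    (⨅ i, ⨆ j, f i j) = ⨆ g : (i : ι) → κ i, ⨅ i, f i (g i)

/-- `↑F` in a preordered set. -/
def upOf {L : Type*} [Preorder L] (F : Set L) : Set L := {z | ∃ f ∈ F, f ≤ z}

/-- `F ≪ x` for a set `F` in a complete lattice. -/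
def finWay {L : Type*} [CompleteLattice L] (F : Set L) (x : L) : Prop :=
  ∀ D : Set L, D.Nonempty → DirectedOn (· ≤ ·) D → x ≤ sSup D → ∃ d ∈ D, ∃ f ∈ F, f ≤ d

/-- Quasicontinuous complete lattice. -/
def QuasicontinuousLattice (L : Type*) [CompleteLattice L] : Prop :=
  ∀ x : L,
    (∀ F G : Set L, F.Finite → finWay F x → G.Finite → finWay G x →
      ∃ H : Set L, H.Finite ∧ finWay H x ∧ upOf H ⊆ upOf F ∧ upOf H ⊆ upOf G) ∧
    Set.Ici x = ⋂₀ {S : Set L | ∃ F : Set L, F.Finite ∧ finWay F x ∧ S = upOf F}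

/-- Algebraic complete lattice: every element is the sup of the compact elements below it. -/
def AlgebraicLattice (L : Type*) [CompleteLattice L] : Prop :=
  ∀ x : L, sSup {k : L | wayBelow k k ∧ k ≤ x} = x

/-- Scott-open subset of a preordered set. -/
def ScottOpen {L : Type*} [Preorder L] (U : Set L) : Prop :=
  IsUpperSet U ∧ ∀ D : Set L, D.Nonempty → DirectedOn (· ≤ ·) D →
    ∀ s : L, IsLUB D s → s ∈ U → (D ∩ U).Nonempty

/-- The Scott topology. -/
def scottSp (L : Type*) [Preorder L] : TopologicalSpace L :=
  TopologicalSpace.generateFrom {U : Set L | ScottOpen U}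

/-- The upper topology. -/
def upperSp (L : Type*) [Preorder L] : TopologicalSpace L :=
  TopologicalSpace.generateFrom {S : Set L | ∃ a : L, S = (Set.Iic a)ᶜ}

theorem specLE_iff' {X : Type*} (t : TopologicalSpace X) (x y : X) :
    specLE t x y ↔ ∀ U : Set X, t.IsOpen U → x ∈ U → y ∈ U := by
  unfold specLE
  rw [@mem_closure_iff X t]
  constructor
  · intro h U hU hx
    obtain ⟨z, hz, rfl⟩ := h U hU hx
    exact hz
  · intro h U hU hx
    exact ⟨y, h U hU hx, rfl⟩

theorem specLE_rfl' {X : Type*} (t : TopologicalSpace X) (x : X) : specLE t x x :=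
  (specLE_iff' t x x).2 fun _ _ h => h

theorem specLE_tr {X : Type*} (t : TopologicalSpace X) {x y z : X} (h : specLE t x y)
    (h' : specLE t y z) : specLE t x z :=
  (specLE_iff' t x z).2 fun U hU hx =>
    (specLE_iff' t y z).1 h' U hU ((specLE_iff' t x y).1 h U hU hx)

theorem specLE_antisymm' {X : Type*} (t : TopologicalSpace X) [T0Space X] {x y : X}
    (h : specLE t x y) (h' : specLE t y x) : x = y := by
  apply T0Space.t0
  rw [inseparable_iff_forall_isOpen]
  intro U hU
  exact ⟨(specLE_iff' t x y).1 h U hU, (specLE_iff' t y x).1 h' U hU⟩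

theorem mem_upSet_single {X : Type*} (t : TopologicalSpace X) (y z : X) :
    z ∈ upSet t {y} ↔ specLE t y z := by simp [upSet]

theorem mem_downSet_single {X : Type*} (t : TopologicalSpace X) (y z : X) :
    z ∈ downSet t {y} ↔ specLE t z y := by simp [downSet]

theorem lower_of_ideal {X : Type*} {t : TopologicalSpace X} {A : Set X} (hA : TopIdeal t A)
    {x y : X} (h : specLE t x y) (hy : y ∈ A) : x ∈ A := by
  rw [← hA.2.1]; exact ⟨y, hy, h⟩

theorem conv_of_ideal {X : Type*} {t : TopologicalSpace X} {A : Set X} (hA : TopIdeal t A)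
    {x : X} (h : IsSupOf t A x) : DConv t A x := by
  obtain ⟨s, hs, hc⟩ := hA.2.2
  intro U hU hx
  exact hc U hU ((specLE_iff' t x s).1 (h.2 s hs.1) U hU hx)

theorem principal_ideal {X : Type*} (t : TopologicalSpace X) (x : X) :
    TopIdeal t (downSet t {x}) := by
  have hx : x ∈ downSet t {x} := (mem_downSet_single t x x).2 (specLE_rfl' t x)
  refine ⟨⟨⟨x, hx⟩, ?_⟩, ?_, x, ⟨?_, ?_⟩, ?_⟩
  · intro a ha b hb
    exact ⟨x, hx, (mem_downSet_single t x a).1 ha, (mem_downSet_single t x b).1 hb⟩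
  · ext z
    constructor
    · rintro ⟨a, ha, hz⟩
      exact (mem_downSet_single t x z).2 (specLE_tr t hz ((mem_downSet_single t x a).1 ha))
    · intro hz
      exact ⟨z, hz, specLE_rfl' t z⟩
  · intro a ha
    exact (mem_downSet_single t x a).1 ha
  · intro y hy
    exact hy x hx
  · intro U hU hxU
    exact ⟨x, hx, hxU⟩

theorem principal_subset {X : Type*} {t : TopologicalSpace X} {A : Set X} (hA : TopIdeal t A)
    (x : X) : downSet t {x} ⊆ A ↔ x ∈ A := by
  constructor
  · intro h
    exact h ((mem_downSet_single t x x).2 (specLE_rfl' t x))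
  · intro h z hz
    exact lower_of_ideal hA ((mem_downSet_single t x z).1 hz) h

theorem omega_basic {X : Type*} (t : TopologicalSpace X) (x : X) :
    OmegaOpen t {A : IT t | x ∈ A.1} := by
  intro A
  constructor
  · intro h
    exact ⟨⟨downSet t {x}, principal_ideal t x⟩,
      (mem_downSet_single t x x).2 (specLE_rfl' t x), ⟨x, rfl⟩, (principal_subset A.2 x).2 h⟩
  · rintro ⟨B, hB, -, hBA⟩
    exact hBA hB

theorem IT_specLE {X : Type*} (t : TopologicalSpace X) (tI : TopologicalSpace (IT t))
    (htI : ∀ U : Set (IT t), tI.IsOpen U ↔ OmegaOpen t U) (A B : IT t) :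
    specLE tI A B ↔ A.1 ⊆ B.1 := by
  rw [specLE_iff']
  constructor
  · intro h x hx
    exact h {A : IT t | x ∈ A.1} ((htI _).2 (omega_basic t x)) hx
  · intro h U hU hA
    rw [htI] at hU
    obtain ⟨C, hC, hCx, hCA⟩ := (hU A).1 hA
    exact (hU B).2 ⟨C, hC, hCx, hCA.trans h⟩

theorem IT_T0 {X : Type*} (t : TopologicalSpace X) (tI : TopologicalSpace (IT t))
    (htI : ∀ U : Set (IT t), tI.IsOpen U ↔ OmegaOpen t U) : @T0Space (IT t) tI := by
  refine @T0Space.mk _ tI ?_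
  intro A B h
  rw [@inseparable_iff_forall_isOpen _ tI] at h
  apply Subtype.ext
  ext x
  exact h {A : IT t | x ∈ A.1} ((htI _).2 (omega_basic t x))

theorem IT_BSpace {X : Type*} (t : TopologicalSpace X) (tI : TopologicalSpace (IT t))
    (htI : ∀ U : Set (IT t), tI.IsOpen U ↔ OmegaOpen t U) : BSpace tI := by
  intro A U hU hA
  have hU' := (htI U).1 hU
  obtain ⟨B, hB, ⟨x, hx⟩, hBA⟩ := (hU' A).1 hA
  refine ⟨B, hB, ?_, ?_, ?_⟩
  · have : upSet tI {B} = {A : IT t | x ∈ A.1} := by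
      ext C
      rw [mem_upSet_single, IT_specLE t tI htI, hx, principal_subset C.2]
      rfl
    rw [this, htI]
    exact omega_basic t x
  · rw [mem_upSet_single, IT_specLE t tI htI]
    exact hBA
  · intro C hC
    rw [mem_upSet_single, specLE_iff'] at hC
    exact hC U hU hB

theorem sup_cont {X : Type*} [t : TopologicalSpace X] (tI : TopologicalSpace (IT t))
    (htI : ∀ U : Set (IT t), tI.IsOpen U ↔ OmegaOpen t U)
    (v : IT t → X) (hv : ∀ A : IT t, IsSupOf t A.1 (v A)) : @Continuous _ _ tI t v := by
  refine (@continuous_def _ _ tI t v).2 fun U hU => ?_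
  refine (htI _).2 fun A => ?_
  constructor
  · intro h
    obtain ⟨x, hxA, hxU⟩ := conv_of_ideal A.2 (hv A) U hU h
    refine ⟨⟨downSet t {x}, principal_ideal t x⟩, ?_, ⟨x, rfl⟩, (principal_subset A.2 x).2 hxA⟩
    exact (specLE_iff' t x _).1
      ((hv ⟨downSet t {x}, principal_ideal t x⟩).1 x
        ((mem_downSet_single t x x).2 (specLE_rfl' t x))) U hU hxU
  · rintro ⟨B, hB, -, hBA⟩
    exact (specLE_iff' t (v B) (v A)).1
      ((hv B).2 _ fun a ha => (hv A).1 a (hBA ha)) U hU hB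

theorem way_sup {X : Type*} [t : TopologicalSpace X] (hc : CSpace t) (x : X) :
    IsSupOf t {y | x ∈ interior (upSet t {y})} x ∧ DConv t {y | x ∈ interior (upSet t {y})} x := by
  refine ⟨⟨?_, ?_⟩, ?_⟩
  · intro a ha
    exact (mem_upSet_single t a x).1 (interior_subset ha)
  · intro w hw
    rw [specLE_iff']
    intro U hU hx
    obtain ⟨y, hyU, hy⟩ := hc x U hU hx
    exact (specLE_iff' t y w).1 (hw y hy) U hU hyU
  · intro U hU hx
    obtain ⟨y, hyU, hy⟩ := hc x U hU hx
    exact ⟨y, hy, hyU⟩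

theorem way_ideal {X : Type*} [t : TopologicalSpace X] (hc : CSpace t) (x : X) :
    TopIdeal t {y | x ∈ interior (upSet t {y})} := by
  refine ⟨⟨?_, ?_⟩, ?_, x, way_sup hc x⟩
  · obtain ⟨y, -, hy⟩ := hc x univ isOpen_univ trivial
    exact ⟨y, hy⟩
  · intro a ha b hb
    obtain ⟨y, hyU, hy⟩ := hc x (interior (upSet t {a}) ∩ interior (upSet t {b}))
      (isOpen_interior.inter isOpen_interior) ⟨ha, hb⟩
    exact ⟨y, hy, (mem_upSet_single t a y).1 (interior_subset hyU.1),
      (mem_upSet_single t b y).1 (interior_subset hyU.2)⟩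
  · ext z
    constructor
    · rintro ⟨a, ha, hz⟩
      refine interior_mono ?_ ha
      intro w hw
      exact (mem_upSet_single t z w).2 (specLE_tr t hz ((mem_upSet_single t a w).1 hw))
    · intro hz
      exact ⟨z, hz, specLE_rfl' t z⟩

theorem c_to_adj {X : Type u} [t : TopologicalSpace X]
    (tI : TopologicalSpace (IT t)) (htI : ∀ U : Set (IT t), tI.IsOpen U ↔ OmegaOpen t U)
    (v : IT t → X) (hv : ∀ A : IT t, IsSupOf t A.1 (v A)) (hc : CSpace t) :
    ∃ s : X → IT t, @Continuous X (IT t) t tI s ∧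
      ∀ (x : X) (A : IT t), ((s x).1 ⊆ A.1 ↔ specLE t x (v A)) := by
  refine ⟨fun x => ⟨_, way_ideal hc x⟩, ?_, ?_⟩
  · refine (@continuous_def _ _ t tI _).2 fun U hU => ?_
    have hU' := (htI U).1 hU
    rw [isOpen_iff_forall_mem_open]
    intro x hx
    obtain ⟨B, hB, ⟨z, hz⟩, hBA⟩ := (hU' _).1 hx
    refine ⟨interior (upSet t {z}), ?_, isOpen_interior, ?_⟩
    · intro w hw
      refine (hU' _).2 ⟨B, hB, ⟨z, hz⟩, ?_⟩
      rw [hz]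
      exact (principal_subset (way_ideal hc w) z).2 hw
    · rw [hz] at hBA
      exact (principal_subset (way_ideal hc x) z).1 hBA
  · intro x A
    constructor
    · intro h
      exact (way_sup hc x).1.2 _ fun a ha => (hv A).1 a (h ha)
    · intro h y hy
      have hy' : v A ∈ interior (upSet t {y}) := (specLE_iff' t x _).1 h _ isOpen_interior hy
      obtain ⟨a, haA, ha⟩ := conv_of_ideal A.2 (hv A) _ isOpen_interior hy'
      exact lower_of_ideal A.2 ((mem_upSet_single t y a).1 (interior_subset ha)) haA

theorem retract_to_c {X : Type u} [t : TopologicalSpace X]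
    (h : ∃ (Y : Type u) (tY : TopologicalSpace Y), @T0Space Y tY ∧ BSpace tY ∧
      ∃ (g : X → Y) (f : Y → X), @Continuous X Y t tY g ∧ @Continuous Y X tY t f ∧
        f ∘ g = id) : CSpace t := by
  obtain ⟨Y, tY, -, hb, g, f, hg, hf, hfg⟩ := h
  have hfg' : ∀ z, f (g z) = z := fun z => congrFun hfg z
  intro x U hU hx
  obtain ⟨y, hyU, hyo, hxy, -⟩ := hb (g x) (f ⁻¹' U) (hf.isOpen_preimage U hU)
    (by simpa [hfg'] using hx)
  refine ⟨f y, hyU, mem_interior.2 ⟨g ⁻¹' (upSet tY {y}), ?_, hg.isOpen_preimage _ hyo, hxy⟩⟩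
  intro z hz
  rw [mem_upSet_single, specLE_iff']
  intro V hV hyV
  have := (specLE_iff' tY y (g z)).1 ((mem_upSet_single tY y _).1 hz) (f ⁻¹' V)
    (hf.isOpen_preimage V hV) hyV
  simpa [hfg'] using this

theorem statement7 {X : Type u} [t : TopologicalSpace X] [T0Space X]
    (tI : TopologicalSpace (IT t)) (htI : ∀ U : Set (IT t), tI.IsOpen U ↔ OmegaOpen t U)
    (v : IT t → X) (hv : ∀ A : IT t, IsSupOf t A.1 (v A)) :
    (CSpace t ↔ ∃ s : X → IT t, @Continuous X (IT t) t tI s ∧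
      ∀ (x : X) (A : IT t), ((s x).1 ⊆ A.1 ↔ specLE t x (v A))) ∧
    (CSpace t ↔ ∃ (Y : Type u) (tY : TopologicalSpace Y), @T0Space Y tY ∧ BSpace tY ∧
      ∃ (g : X → Y) (f : Y → X), @Continuous X Y t tY g ∧ @Continuous Y X tY t f ∧
        f ∘ g = id) := by
  have h12 := c_to_adj tI htI v hv
  have h23 : (∃ s : X → IT t, @Continuous X (IT t) t tI s ∧
      ∀ (x : X) (A : IT t), ((s x).1 ⊆ A.1 ↔ specLE t x (v A))) →
      ∃ (Y : Type u) (tY : TopologicalSpace Y), @T0Space Y tY ∧ BSpace tY ∧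
      ∃ (g : X → Y) (f : Y → X), @Continuous X Y t tY g ∧ @Continuous Y X tY t f ∧
        f ∘ g = id := by
    rintro ⟨s, hs, hadj⟩
    refine ⟨IT t, tI, IT_T0 t tI htI, IT_BSpace t tI htI, s, v, hs, sup_cont tI htI v hv, ?_⟩
    funext x
    apply specLE_antisymm' t
    · refine (hv (s x)).2 x fun a ha => ?_
      have h1 : (s x).1 ⊆ downSet t {x} :=
        (hadj x ⟨downSet t {x}, principal_ideal t x⟩).2
          ((hv _).1 x ((mem_downSet_single t x x).2 (specLE_rfl' t x)))
      exact (mem_downSet_single t x a).1 (h1 ha)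
    · exact (hadj x (s x)).1 (Subset.refl _)
  have h31 := retract_to_c (X := X)
  exact ⟨⟨h12, fun h => h31 (h23 h)⟩, ⟨fun h => h23 (h12 h), h31⟩⟩
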